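/- Let F = ℚ(√D) be a real quadratic field with discriminant Δ, and let I be a nonzero ideal of O_F. If the lattice σ(I) obtained from the canonical embedding of I is well-rounded, then N(I) ≥ √(3Δ)/4. -/

import Mathlib

noncomputable section

open scoped BigOperators

/-- Squared Euclidean norm on `ℝⁿ`. -/
def sqnorm {n : ℕ} (x : Fin n → ℝ) : ℝ := ∑ i, (x i) ^ 2

/-- The minimum distance `λ₁` of a lattice: the infimum of squared norms of nonzero vectors. -/
def lambda1 {n : ℕ} (L : Submodule ℤ (Fin n → ℝ)) : ℝ :=
  sInf {r : ℝ | ∃ x ∈ L, x ≠ 0 ∧ sqnorm x = r}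

/-- A minimal vector of the lattice `L`. -/
def IsMinVec {n : ℕ} (L : Submodule ℤ (Fin n → ℝ)) (x : Fin n → ℝ) : Prop :=
  x ∈ L ∧ x ≠ 0 ∧ sqnorm x = lambda1 L

/-- A lattice is well-rounded if it has `n` linearly independent minimal vectors. -/
def IsWellRounded {n : ℕ} (L : Submodule ℤ (Fin n → ℝ)) : Prop :=
  ∃ v : Fin n → Fin n → ℝ, (∀ i, IsMinVec L (v i)) ∧ LinearIndependent ℝ v

/-- `L` is a full-rank lattice in `ℝⁿ`. -/
def IsFullLattice {n : ℕ} (L : Submodule ℤ (Fin n → ℝ)) : Prop :=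
  ∃ b : Fin n → Fin n → ℝ, LinearIndependent ℝ b ∧ L = Submodule.span ℤ (Set.range b)

/-- Covolume of the lattice spanned by the basis `b`. -/
def covolOf {n : ℕ} (b : Fin n → Fin n → ℝ) : ℝ := |Matrix.det (Matrix.of b)|

/-- The Hermite constant in dimension `n`. -/
def hermiteConstant (n : ℕ) : ℝ :=
  sSup {c : ℝ | ∃ (L : Submodule ℤ (Fin n → ℝ)) (b : Fin n → Fin n → ℝ),
    LinearIndependent ℝ b ∧ L = Submodule.span ℤ (Set.range b) ∧
    c = lambda1 L / (covolOf b) ^ ((2 : ℝ) / n)}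

/-- Canonical embedding of `a + b √D` into `ℝ²` for the real quadratic field `ℚ(√D)`. -/
def embQ (D a b : ℝ) : Fin 2 → ℝ := ![a + b * Real.sqrt D, a - b * Real.sqrt D]

/-- The lattice `ℤⁿ` inside `ℝⁿ`. -/
def intLat (n : ℕ) : Submodule ℤ (Fin n → ℝ) :=
  Submodule.span ℤ (Set.range fun i : Fin n => (Pi.single i 1 : Fin n → ℝ))

open NumberField

lemma aux_univ (K : Type) [Field K] [NumberField K] (hdeg : Module.finrank ℚ K = 2)
    (σ₁ σ₂ : K →+* ℝ) (hσ : σ₁ ≠ σ₂) :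
    ∃ φ₁ φ₂ : K →ₐ[ℚ] ℂ, φ₁ ≠ φ₂ ∧ (∀ x, φ₁ x = (σ₁ x : ℂ)) ∧ (∀ x, φ₂ x = (σ₂ x : ℂ)) ∧
      ∀ [DecidableEq (K →ₐ[ℚ] ℂ)], (Finset.univ : Finset (K →ₐ[ℚ] ℂ)) = {φ₁, φ₂} := by
  refine ⟨(Complex.ofRealHom.comp σ₁).toRatAlgHom, (Complex.ofRealHom.comp σ₂).toRatAlgHom,
    ?_, fun _ => rfl, fun _ => rfl, ?_⟩
  · intro h
    apply hσ
    ext x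
    have := DFunLike.congr_fun h x
    exact Complex.ofReal_injective this
  · intro _
    symm
    apply Finset.eq_univ_of_card
    rw [AlgHom.card, hdeg, Finset.card_pair]
    intro h
    apply hσ
    ext x
    have := DFunLike.congr_fun h x
    exact Complex.ofReal_injective this

lemma aux_tr (K : Type) [Field K] [NumberField K] (hdeg : Module.finrank ℚ K = 2)
    (σ₁ σ₂ : K →+* ℝ) (hσ : σ₁ ≠ σ₂) (x : 𝓞 K) :
    ∃ t n : ℤ, σ₁ (x : K) + σ₂ (x : K) = t ∧ σ₁ (x : K) * σ₂ (x : K) = n := by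
  classical
  obtain ⟨φ₁, φ₂, hne, h1, h2, hu⟩ := aux_univ K hdeg σ₁ σ₂ hσ
  refine ⟨Algebra.trace ℤ (𝓞 K) x, Algebra.norm ℤ x, ?_, ?_⟩
  · have h := trace_eq_sum_embeddings (K := ℚ) (L := K) ℂ (x := (x : K))
    rw [hu, Finset.sum_pair hne, h1, h2, ← Algebra.coe_trace_int] at h
    have : (((Algebra.trace ℤ (𝓞 K) x : ℤ) : ℝ) : ℂ) = ((σ₁ (x:K) + σ₂ (x:K) : ℝ) : ℂ) := by
      push_cast
      simpa using h
    exact (Complex.ofReal_injective this).symm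
  · have h := Algebra.norm_eq_prod_embeddings ℚ (L := K) ℂ (x : K)
    rw [hu, Finset.prod_pair hne, h1, h2, ← Algebra.coe_norm_int] at h
    have : (((Algebra.norm ℤ x : ℤ) : ℝ) : ℂ) = ((σ₁ (x:K) * σ₂ (x:K) : ℝ) : ℂ) := by
      push_cast
      simpa using h
    exact (Complex.ofReal_injective this).symm

lemma aux_det (K : Type) [Field K] [NumberField K]
    (σ₁ σ₂ : K →+* ℝ) (b : Module.Basis (Fin 2) ℤ (𝓞 K)) (v : Fin 2 → 𝓞 K) :
    σ₁ (v 0 : K) * σ₂ (v 1 : K) - σ₁ (v 1 : K) * σ₂ (v 0 : K) =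
      (b.det v : ℝ) * (σ₁ (b 0 : K) * σ₂ (b 1 : K) - σ₁ (b 1 : K) * σ₂ (b 0 : K)) := by
  have key : ∀ (σ : K →+* ℝ) (x : 𝓞 K), σ (x : K) =
      (b.repr x 0 : ℝ) * σ (b 0 : K) + (b.repr x 1 : ℝ) * σ (b 1 : K) := by
    intro σ x
    conv_lhs => rw [← b.sum_repr x, Fin.sum_univ_two]
    simp
  rw [key σ₁ (v 0), key σ₁ (v 1), key σ₂ (v 0), key σ₂ (v 1), Module.Basis.det_apply,
    Matrix.det_fin_two]
  simp only [Module.Basis.toMatrix_apply]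
  push_cast
  ring

/-- A ℤ-lattice in ℝ² argument: reduction modulo two minimal vectors. -/
lemma aux_gen (K : Type) [Field K] [NumberField K]
    (σ₁ σ₂ : K →+* ℝ) (I : Ideal (𝓞 K)) (lam : ℝ) (hpos : 0 < lam)
    (hmin : ∀ z ∈ I, z ≠ 0 → lam ≤ σ₁ (z : K) ^ 2 + σ₂ (z : K) ^ 2)
    (x y : 𝓞 K) (hx : x ∈ I) (hy : y ∈ I)
    (hxl : σ₁ (x : K) ^ 2 + σ₂ (x : K) ^ 2 = lam)
    (hyl : σ₁ (y : K) ^ 2 + σ₂ (y : K) ^ 2 = lam)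
    (hip : |σ₁ (x : K) * σ₁ (y : K) + σ₂ (x : K) * σ₂ (y : K)| ≤ lam / 2)
    (hd : σ₁ (x : K) * σ₂ (y : K) - σ₁ (y : K) * σ₂ (x : K) ≠ 0) (w : 𝓞 K) (hw : w ∈ I) :
    ∃ s t : ℤ, w = s * x + t * y := by
  set a := σ₁ (x : K)
  set a' := σ₂ (x : K)
  set c := σ₁ (y : K)
  set c' := σ₂ (y : K)
  set d := a * c' - c * a' with hdd
  set S := (σ₁ (w : K) * c' - c * σ₂ (w : K)) / d with hS
  set T := (a * σ₂ (w : K) - σ₁ (w : K) * a') / d with hT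
  have e1 : σ₁ (w : K) = S * a + T * c := by
    rw [hS, hT]; field_simp; rw [hdd]; ring
  have e2 : σ₂ (w : K) = S * a' + T * c' := by
    rw [hS, hT]; field_simp; rw [hdd]; ring
  refine ⟨round S, round T, ?_⟩
  by_contra hne
  have hz : w - ((round S : ℤ) * x + (round T : ℤ) * y) ∈ I :=
    I.sub_mem hw (I.add_mem (I.mul_mem_left _ hx) (I.mul_mem_left _ hy))
  have h := hmin _ hz (sub_ne_zero.mpr hne)
  have f1 : σ₁ ((w - ((round S : ℤ) * x + (round T : ℤ) * y) : 𝓞 K) : K)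
      = (S - round S) * a + (T - round T) * c := by
    simp only [map_sub, map_add, map_mul, map_intCast]
    rw [e1]; ring
  have f2 : σ₂ ((w - ((round S : ℤ) * x + (round T : ℤ) * y) : 𝓞 K) : K)
      = (S - round S) * a' + (T - round T) * c' := by
    simp only [map_sub, map_add, map_mul, map_intCast]
    rw [e2]; ring
  rw [f1, f2] at h
  have g1 := abs_sub_round S
  have g2 := abs_sub_round T
  set s := S - round S
  set t := T - round T
  have k1 : s ^ 2 ≤ 1 / 4 := by
    rw [← sq_abs]; nlinarith [abs_nonneg s]
  have k2 : t ^ 2 ≤ 1 / 4 := by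
    rw [← sq_abs]; nlinarith [abs_nonneg t]
  have k3 : (s * t) * (a * c + a' * c') ≤ 1 / 4 * (lam / 2) := by
    refine (le_abs_self _).trans ?_
    rw [abs_mul, abs_mul]
    refine mul_le_mul ?_ hip (abs_nonneg _) (by norm_num)
    nlinarith [abs_nonneg s, abs_nonneg t]
  have : (s * a + t * c) ^ 2 + (s * a' + t * c') ^ 2
      = s ^ 2 * lam + t ^ 2 * lam + 2 * ((s * t) * (a * c + a' * c')) := by
    rw [← hxl]
    nth_rewrite 2 [hxl]
    rw [← hyl]; ring
  nlinarith

lemma aux_disc (D : ℕ) (hsf : Squarefree D) (d m : ℤ) (h : m ^ 2 * d = 4 * D)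
    (P n : ℤ) (hd : d = P ^ 2 - 4 * n) (Δ : ℕ) (hΔ : Δ = if D % 4 = 1 then D else 4 * D) :
    (Δ : ℤ) ≤ d := by
  have hD0 : D ≠ 0 := hsf.ne_zero
  have hP : P ^ 2 % 4 = 0 ∨ P ^ 2 % 4 = 1 := by
    rcases Int.even_or_odd' P with ⟨k, rfl | rfl⟩ <;> ring_nf <;> omega
  have hdpos : 0 < d := by
    have : (0:ℤ) < m ^ 2 * d := by rw [h]; positivity
    exact pos_of_mul_pos_right this (sq_nonneg m) 
  have hsfZ : Squarefree (D : ℤ) := Int.squarefree_natCast.mpr hsf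
  rcases Int.even_or_odd' m with ⟨k, rfl | rfl⟩
  · have hk : k ^ 2 * d = D := by linarith [show (2*k)^2*d = 4 * (k^2*d) by ring]
    have hu := hsfZ k ⟨d, by rw [← hk]; ring⟩
    have hk1 : k ^ 2 = 1 := by
      rcases Int.isUnit_iff.mp hu with rfl | rfl <;> norm_num
    rw [hk1, one_mul] at hk
    have hD4 : ¬ (4 ∣ D) := by
      intro ⟨c, hc⟩
      have := hsf 2 ⟨c, by omega⟩
      simp at this
    rw [if_pos (by omega)] at hΔ
    omega
  · have hco : IsCoprime ((2 * k + 1) * (2 * k + 1)) (4 : ℤ) := by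
      have : IsCoprime (2 * k + 1) (2 : ℤ) := ⟨1, -k, by ring⟩
      have h4 : IsCoprime (2 * k + 1) (4 : ℤ) := by
        have := this.mul_right this
        norm_num at this
        exact this
      exact h4.mul_left h4
    have hdv : (2 * k + 1) * (2 * k + 1) ∣ (D : ℤ) :=
      hco.dvd_of_dvd_mul_left ⟨d, by rw [← h]; ring⟩
    have hu := hsfZ _ hdv
    have hk1 : (2 * k + 1) ^ 2 = 1 := by
      rcases Int.isUnit_iff.mp hu with h | h <;> rw [h] <;> norm_num
    rw [hk1, one_mul] at h
    split_ifs at hΔ <;> omega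

set_option maxHeartbeats 1000000


/-- if the canonical-embedding lattice of a nonzero ideal `I` of a real
quadratic field `ℚ(√D)` of discriminant `Δ` is well-rounded, then `N(I) ≥ √(3Δ)/4`. -/
theorem stmt_4 (D : ℕ) (hsf : Squarefree D) (hD : 1 < D)
    (K : Type) [Field K] [NumberField K]
    (hdeg : Module.finrank ℚ K = 2)
    (α : K) (hα : α ^ 2 = (D : K))
    (σ₁ σ₂ : K →+* ℝ) (hσ : σ₁ ≠ σ₂)
    (Δ : ℕ) (hΔ : Δ = if D % 4 = 1 then D else 4 * D)
    (I : Ideal (𝓞 K)) (hI : I ≠ ⊥)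
    (hWR : IsWellRounded (Submodule.span ℤ
      ((fun x : K => ![σ₁ x, σ₂ x]) '' (algebraMap (𝓞 K) K '' (I : Set (𝓞 K)))))) :
    (Ideal.absNorm I : ℝ) ≥ Real.sqrt (3 * Δ) / 4 := by
  classical
  -- minimal vectors
  have hLmem : ∀ v ∈ Submodule.span ℤ
      ((fun x : K => ![σ₁ x, σ₂ x]) '' (algebraMap (𝓞 K) K '' (I : Set (𝓞 K)))),
      ∃ x ∈ I, v = ![σ₁ (x : K), σ₂ (x : K)] := by
    intro v hv
    induction hv using Submodule.span_induction with
    | mem v hv =>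
      obtain ⟨_, ⟨x, hx, rfl⟩, rfl⟩ := hv
      exact ⟨x, hx, rfl⟩
    | zero => exact ⟨0, I.zero_mem, by ext i; fin_cases i <;> simp⟩
    | add v w _ _ hv hw =>
      obtain ⟨x, hx, rfl⟩ := hv
      obtain ⟨y, hy, rfl⟩ := hw
      exact ⟨x + y, I.add_mem hx hy, by ext i; fin_cases i <;> simp⟩
    | smul a v _ hv =>
      obtain ⟨x, hx, rfl⟩ := hv
      exact ⟨a * x, I.mul_mem_left _ hx, by ext i; fin_cases i <;> simp⟩
  have hmemL : ∀ x ∈ I, ![σ₁ (x : K), σ₂ (x : K)] ∈ Submodule.span ℤ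
      ((fun x : K => ![σ₁ x, σ₂ x]) '' (algebraMap (𝓞 K) K '' (I : Set (𝓞 K)))) := by
    intro x hx
    exact Submodule.subset_span ⟨_, ⟨x, hx, rfl⟩, rfl⟩
  obtain ⟨v, hv, hli⟩ := hWR
  set L := Submodule.span ℤ
      ((fun x : K => ![σ₁ x, σ₂ x]) '' (algebraMap (𝓞 K) K '' (I : Set (𝓞 K)))) with hL
  set lam := lambda1 L with hlam
  have hsq : ∀ a b : ℝ, sqnorm ![a, b] = a ^ 2 + b ^ 2 := by
    intro a b; simp [sqnorm, Fin.sum_univ_two]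
  have hσ0 : ∀ z : 𝓞 K, z ≠ 0 → σ₁ (z : K) ≠ 0 := by
    intro z hz
    rw [map_ne_zero]
    exact_mod_cast hz
  have hmin : ∀ z ∈ I, z ≠ 0 → lam ≤ σ₁ (z : K) ^ 2 + σ₂ (z : K) ^ 2 := by
    intro z hz hz0
    refine csInf_le ⟨0, ?_⟩ ⟨_, hmemL z hz, ?_, hsq _ _⟩
    · rintro r ⟨x, -, -, rfl⟩
      exact Finset.sum_nonneg fun i _ => sq_nonneg _
    · intro h
      exact hσ0 z hz0 (congrFun h 0)
  obtain ⟨hm0, hne0, hl0⟩ := hv 0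
  obtain ⟨hm1, hne1, hl1⟩ := hv 1
  obtain ⟨x, hx, hvx⟩ := hLmem _ hm0
  obtain ⟨y, hy, hvy⟩ := hLmem _ hm1
  rw [hvx, hsq] at hl0
  rw [hvy, hsq] at hl1
  have hx0 : x ≠ 0 := by
    rintro rfl
    apply hne0
    rw [hvx]; ext i; fin_cases i <;> simp
  have hpos : 0 < lam := by
    rw [hlam, ← hl0]
    have := hσ0 x hx0
    positivity
  have hd : σ₁ (x : K) * σ₂ (y : K) - σ₁ (y : K) * σ₂ (x : K) ≠ 0 := by
    intro h
    have hu : IsUnit (Matrix.of v) := by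
      rw [← Matrix.linearIndependent_rows_iff_isUnit]
      exact hli
    rw [Matrix.isUnit_iff_isUnit_det, Matrix.det_fin_two, isUnit_iff_ne_zero] at hu
    apply hu
    simp only [Matrix.of_apply, hvx, hvy]
    simpa [mul_comm] using h
  have hip : |σ₁ (x : K) * σ₁ (y : K) + σ₂ (x : K) * σ₂ (y : K)| ≤ lam / 2 := by
    have h1 := hmin (x + y) (I.add_mem hx hy) (by
      intro h
      apply hd
      rw [eq_neg_of_add_eq_zero_left h]; simp)
    have h2 := hmin (x - y) (I.sub_mem hx hy) (by
      intro h
      apply hd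
      rw [sub_eq_zero.mp h]; ring)
    simp only [map_add, map_sub] at h1 h2
    rw [abs_le]
    constructor <;> nlinarith
  have hgen := aux_gen K σ₁ σ₂ I lam hpos hmin x y hx hy hl0 hl1 hip hd
  -- bases
  have hrk : Module.finrank ℤ (𝓞 K) = 2 := by rw [RingOfIntegers.rank, hdeg]
  obtain ⟨b⟩ : Nonempty (Module.Basis (Fin 2) ℤ (𝓞 K)) :=
    ⟨Module.finBasisOfFinrankEq ℤ (𝓞 K) hrk⟩
  obtain ⟨e⟩ : Nonempty (Module.Basis (Fin 2) ℤ I) := ⟨Ideal.selfBasis b I hI⟩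
  have hN := Ideal.natAbs_det_basis_change b I e
  set δ := σ₁ (b 0 : K) * σ₂ (b 1 : K) - σ₁ (b 1 : K) * σ₂ (b 0 : K) with hδ
  have hdet := fun v => aux_det K σ₁ σ₂ b v
  rw [← hδ] at hdet
  -- discriminant
  obtain ⟨t0, n0, ht0, hn0⟩ := aux_tr K hdeg σ₁ σ₂ hσ (b 0)
  obtain ⟨t1, n1, ht1, hn1⟩ := aux_tr K hdeg σ₁ σ₂ hσ (b 1)
  obtain ⟨t2, n2, ht2, hn2⟩ := aux_tr K hdeg σ₁ σ₂ hσ (b 0 * b 1)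
  simp only [map_mul] at ht2
  have hδd : δ ^ 2 = (((t0 * t1 - t2) ^ 2 - 4 * (n0 * n1) : ℤ) : ℝ) := by
    push_cast
    rw [← ht0, ← ht1, ← ht2, ← hn0, ← hn1, hδ]
    ring
  have hαint : IsIntegral ℤ α := by
    apply IsIntegral.of_pow (n := 2) (by norm_num)
    rw [hα]
    exact isIntegral_natCast D
  let a : 𝓞 K := ⟨α, hαint⟩
  have hs1 : σ₁ α ^ 2 = D := by rw [← map_pow, hα, map_natCast]
  have hs2 : σ₂ α ^ 2 = D := by rw [← map_pow, hα, map_natCast]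
  have hdα := hdet ![1, a]
  have hdα' : σ₂ α - σ₁ α = (b.det ![1, a] : ℝ) * δ := by
    rw [← hdα]; simp; rfl
  set m : ℤ := b.det ![1, a] with hm
  have hsum : σ₂ α = - σ₁ α := by
    rcases sq_eq_sq_iff_eq_or_eq_neg.mp (hs2.trans hs1.symm) with h | h
    · exfalso
      obtain ⟨t, n, ht, hn⟩ := aux_tr K hdeg σ₁ σ₂ hσ a
      have ht' : σ₁ α + σ₂ α = t := ht
      have ht4 : (t : ℝ) ^ 2 = 4 * D := by
        rw [← ht', h, ← hs1]; ring
      have ht4' : t ^ 2 = 4 * (D : ℤ) := by exact_mod_cast ht4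
      rcases Int.even_or_odd' t with ⟨k, rfl | rfl⟩
      · have hk : k * k = (D : ℤ) := by nlinarith
        have hsfZ : Squarefree (D : ℤ) := Int.squarefree_natCast.mpr hsf
        have hu := hsfZ k ⟨1, by rw [hk]; ring⟩
        rcases Int.isUnit_iff.mp hu with rfl | rfl <;> omega
      · ring_nf at ht4'
        omega
    · exact h
  have hmd : m ^ 2 * ((t0 * t1 - t2) ^ 2 - 4 * (n0 * n1)) = 4 * (D : ℤ) := by
    have h1 : (m : ℝ) ^ 2 * δ ^ 2 = 4 * D := by
      rw [← mul_pow, ← hdα', hsum, ← hs1]; ring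
    rw [hδd] at h1
    exact_mod_cast h1
  have hΔd : (Δ : ℝ) ≤ δ ^ 2 := by
    rw [hδd]
    exact_mod_cast aux_disc D hsf _ m hmd _ _ rfl Δ hΔ
  have hΔpos : (0 : ℝ) < Δ := by
    have : 0 < Δ := by rw [hΔ]; split_ifs <;> omega
    exact_mod_cast this
  have hδpos : 0 < δ ^ 2 := hΔpos.trans_le hΔd
  have hδ0 : δ ≠ 0 := fun h => by simp [h] at hδpos
  -- lower bound for the minimum
  have hlow : ∀ z : 𝓞 K, σ₁ (z : K) ^ 2 + σ₂ (z : K) ^ 2 = lam → σ₁ (z : K) ≠ σ₂ (z : K) →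
      δ ^ 2 / 2 ≤ lam := by
    intro z hz hz'
    have h := hdet ![1, z]
    have h' : σ₂ (z : K) - σ₁ (z : K) = (b.det ![1, z] : ℝ) * δ := by
      rw [← h]; simp
    have hk : b.det ![1, z] ≠ 0 := by
      intro hk
      rw [hk] at h'
      apply hz'
      simp at h'
      linarith
    have hk1 : (1 : ℝ) ≤ (b.det ![1, z] : ℝ) ^ 2 := by
      have : 1 ≤ (b.det ![1, z]) ^ 2 := by
        have := sq_nonneg (b.det ![1, z])
        have := pow_ne_zero 2 hk
        omega
      exact_mod_cast this
    have h2 : (σ₂ (z : K) - σ₁ (z : K)) ^ 2 = (b.det ![1, z] : ℝ) ^ 2 * δ ^ 2 := by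
      rw [h', mul_pow]
    have h3 : δ ^ 2 ≤ (σ₂ (z : K) - σ₁ (z : K)) ^ 2 := by
      rw [h2]
      exact le_mul_of_one_le_left hδpos.le hk1
    have h4 := sq_nonneg (σ₂ (z : K) + σ₁ (z : K))
    rw [sub_sq] at h3
    rw [add_sq] at h4
    linarith
  have hlam2 : δ ^ 2 / 2 ≤ lam := by
    by_cases h1 : σ₁ (x : K) = σ₂ (x : K)
    · by_cases h2 : σ₁ (y : K) = σ₂ (y : K)
      · exfalso; apply hd; rw [h1, h2]; ring
      · exact hlow y hl1 h2
    · exact hlow x hl0 h1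
  -- covolume
  set N : ℝ := (Ideal.absNorm I : ℝ) with hNdef
  have hN0 : Ideal.absNorm I ≠ 0 := by
    rw [Ne, Ideal.absNorm_eq_zero_iff]; exact hI
  have hNpos : 0 < N := by
    rw [hNdef]; exact_mod_cast Nat.pos_of_ne_zero hN0
  have hNsq : (b.det ((↑) ∘ e) : ℝ) ^ 2 = N ^ 2 := by
    rw [hNdef, ← hN, Nat.cast_natAbs, Int.cast_abs, sq_abs]
  have hcov : N ^ 2 * δ ^ 2 =
      (σ₁ ((e 0 : 𝓞 K) : K) * σ₂ ((e 1 : 𝓞 K) : K)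
        - σ₁ ((e 1 : 𝓞 K) : K) * σ₂ ((e 0 : 𝓞 K) : K)) ^ 2 := by
    have h := hdet ((↑) ∘ e)
    rw [← hNsq, ← mul_pow, ← h]
    rfl
  obtain ⟨s, t, hst⟩ := hgen _ (e 0).2
  obtain ⟨s', t', hst'⟩ := hgen _ (e 1).2
  rw [hst, hst'] at hcov
  simp only [map_add, map_mul, map_intCast] at hcov
  have hcov2 : N ^ 2 * δ ^ 2 = ((s * t' - s' * t : ℤ) : ℝ) ^ 2 *
      (σ₁ (x : K) * σ₂ (y : K) - σ₁ (y : K) * σ₂ (x : K)) ^ 2 := by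
    rw [hcov]; push_cast; ring
  have hq : s * t' - s' * t ≠ 0 := by
    intro h
    rw [h] at hcov2
    have : 0 < N ^ 2 * δ ^ 2 := by positivity
    rw [hcov2] at this
    simp at this
  have hq1 : (1 : ℝ) ≤ ((s * t' - s' * t : ℤ) : ℝ) ^ 2 := by
    have : 1 ≤ (s * t' - s' * t) ^ 2 := by
      have := sq_nonneg (s * t' - s' * t)
      have := pow_ne_zero 2 hq
      omega
    exact_mod_cast this
  have hdlow : 3 / 4 * lam ^ 2 ≤
      (σ₁ (x : K) * σ₂ (y : K) - σ₁ (y : K) * σ₂ (x : K)) ^ 2 := by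
    have h1 : (σ₁ (x : K) * σ₂ (y : K) - σ₁ (y : K) * σ₂ (x : K)) ^ 2 =
        lam * lam - (σ₁ (x : K) * σ₁ (y : K) + σ₂ (x : K) * σ₂ (y : K)) ^ 2 := by
      have hl0' : lam = σ₁ (x : K) ^ 2 + σ₂ (x : K) ^ 2 := hl0.symm
      have hl1' : lam = σ₁ (y : K) ^ 2 + σ₂ (y : K) ^ 2 := hl1.symm
      calc _ = (σ₁ (x : K) ^ 2 + σ₂ (x : K) ^ 2) * (σ₁ (y : K) ^ 2 + σ₂ (y : K) ^ 2)
            - (σ₁ (x : K) * σ₁ (y : K) + σ₂ (x : K) * σ₂ (y : K)) ^ 2 := by ring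
        _ = _ := by rw [← hl0', ← hl1']
    have h2 : (σ₁ (x : K) * σ₁ (y : K) + σ₂ (x : K) * σ₂ (y : K)) ^ 2 ≤ (lam / 2) ^ 2 := by
      rw [← sq_abs]
      gcongr
    rw [h1]
    have h3 : (lam / 2) ^ 2 = lam * lam - 3 / 4 * lam ^ 2 := by ring
    linarith
  have hfin1 : 3 / 4 * lam ^ 2 ≤ N ^ 2 * δ ^ 2 := by
    rw [hcov2]
    exact hdlow.trans (le_mul_of_one_le_left (sq_nonneg _) hq1)
  have hfin2 : (δ ^ 2 / 2) ^ 2 ≤ lam ^ 2 := by gcongr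
  have hfin3 : 3 / 16 * δ ^ 2 ≤ N ^ 2 := by
    have : (3 / 16 * δ ^ 2) * δ ^ 2 ≤ N ^ 2 * δ ^ 2 := by
      have h5 : (3 / 16 * δ ^ 2) * δ ^ 2 = 3 / 4 * (δ ^ 2 / 2) ^ 2 := by ring
      linarith
    exact le_of_mul_le_mul_right this hδpos
  have hle : Real.sqrt (3 * Δ) ≤ 4 * N := by
    rw [Real.sqrt_le_left (by positivity)]
    have h6 : (4 * N) ^ 2 = 16 * N ^ 2 := by ring
    linarith
  linarith
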